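/- arXiv:1112.5311 — 6 statements merged into one kernel-verified Lean document; each statement's English description precedes it below -/
import Mathlib

section
/- Let M be a real vector space and S : M → M a linear endomorphism. Define sequences Φ, Ψ : ℕ → M by Φ_{n+1} = (1/2)·S(Φ_n) − (id − S²/4)(Ψ_n) and Ψ_{n+1} = (1/2)·S(Ψ_n) + Φ_n. Then for every n ≥ 1, Φ_n = P_n(S/2)(Φ_0) − (id − S²/4)(Q_{n−1}(S/2)(Ψ_0)) and Ψ_n = P_n(S/2)(Ψ_0) + Q_{n−1}(S/2)(Φ_0). -/
open Polynomial

/-- The closed form, valid for all `n`, of the recurrence driven by an endomorphism `A`, with the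
operator `1 - A ^ 2` written as a polynomial in `A`. -/
theorem chebyshev_recurrence_closed_form {R M : Type*} [CommRing R] [AddCommGroup M] [Module R M]
    (A : Module.End R M) (Φ Ψ : ℕ → M)
    (hΦ : ∀ n, Φ (n + 1) = A (Φ n) - aeval A (1 - X ^ 2 : R[X]) (Ψ n))
    (hΨ : ∀ n, Ψ (n + 1) = A (Ψ n) + Φ n) (n : ℕ) :
    Φ n = aeval A (Chebyshev.T R n) (Φ 0)
        - aeval A (1 - X ^ 2 : R[X]) (aeval A (Chebyshev.U R ((n : ℤ) - 1)) (Ψ 0))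
      ∧ Ψ n = aeval A (Chebyshev.T R n) (Ψ 0)
        + aeval A (Chebyshev.U R ((n : ℤ) - 1)) (Φ 0) := by
  induction n with
  | zero => simp
  | succ n ih =>
    obtain ⟨ihΦ, ihΨ⟩ := ih
    have hT : Chebyshev.T R ((n : ℤ) + 1) =
        X * Chebyshev.T R n - (1 - X ^ 2) * Chebyshev.U R ((n : ℤ) - 1) := by
      have h := Chebyshev.T_eq_X_mul_T_sub_pol_U R ((n : ℤ) - 1)
      rwa [show (n : ℤ) - 1 + 2 = n + 1 by ring, sub_add_cancel] at h
    have hU : Chebyshev.U R (n : ℤ) = X * Chebyshev.U R ((n : ℤ) - 1) + Chebyshev.T R n := by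
      have h := Chebyshev.U_eq_X_mul_U_add_T R ((n : ℤ) - 1)
      rwa [sub_add_cancel] at h
    have hcomm (v : M) : A (aeval A (1 - X ^ 2 : R[X]) v) = aeval A (1 - X ^ 2 : R[X]) (A v) := by
      have h : aeval A (X * (1 - X ^ 2) : R[X]) v = aeval A ((1 - X ^ 2) * X : R[X]) v := by
        rw [mul_comm]
      simpa only [map_mul, aeval_X, Module.End.mul_apply] using h
    have hcast : ((n + 1 : ℕ) : ℤ) = n + 1 := by push_cast; rfl
    rw [hΦ, hΨ, ihΦ, ihΨ, hcast, add_sub_cancel_right, hT, hU]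
    generalize (1 - X ^ 2 : R[X]) = p at hcomm ⊢
    simp only [map_sub, map_add, map_mul, aeval_X, Module.End.mul_apply, LinearMap.sub_apply,
      LinearMap.add_apply, hcomm]
    constructor <;> abel

/-- Closed-form solution of the p-adic wave equation: if
`Φ_{n+1} = (1/2)S Φ_n − (1 − S²/4) Ψ_n` and `Ψ_{n+1} = (1/2)S Ψ_n + Φ_n`, then for `n ≥ 1`,
`Φ_n = P_n(S/2) Φ_0 − (1 − S²/4) Q_{n−1}(S/2) Ψ_0` and `Ψ_n = P_n(S/2) Ψ_0 + Q_{n−1}(S/2) Φ_0`,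
where `P`, `Q` are Chebyshev polynomials of the first and second kind. -/
theorem stmt_2 (M : Type*) [AddCommGroup M] [Module ℝ M]
    (S : Module.End ℝ M) (Φ Ψ : ℕ → M)
    (hΦ : ∀ n : ℕ, Φ (n + 1) =
      ((1 / 2 : ℝ) • S) (Φ n) - ((1 - (1 / 4 : ℝ) • S ^ 2 : Module.End ℝ M)) (Ψ n))
    (hΨ : ∀ n : ℕ, Ψ (n + 1) = ((1 / 2 : ℝ) • S) (Ψ n) + Φ n)
    (n : ℕ) (hn : 1 ≤ n) :
    Φ n = (Polynomial.aeval ((1 / 2 : ℝ) • S) (Polynomial.Chebyshev.T ℝ n)) (Φ 0)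
        - ((1 - (1 / 4 : ℝ) • S ^ 2 : Module.End ℝ M))
            ((Polynomial.aeval ((1 / 2 : ℝ) • S) (Polynomial.Chebyshev.U ℝ ((n : ℤ) - 1))) (Ψ 0))
      ∧ Ψ n = (Polynomial.aeval ((1 / 2 : ℝ) • S) (Polynomial.Chebyshev.T ℝ n)) (Ψ 0)
        + (Polynomial.aeval ((1 / 2 : ℝ) • S) (Polynomial.Chebyshev.U ℝ ((n : ℤ) - 1))) (Φ 0) := by
  have hB : (1 - (1 / 4 : ℝ) • S ^ 2 : Module.End ℝ M) =
      aeval ((1 / 2 : ℝ) • S) (1 - X ^ 2 : ℝ[X]) := by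
    simp only [map_sub, map_one, map_pow, aeval_X, _root_.smul_pow]
    norm_num
  simp only [hB] at hΦ ⊢
  exact chebyshev_recurrence_closed_form _ Φ Ψ hΦ hΨ n
end

section
/- Let H be a real Hilbert space and S : H → H a continuous self-adjoint linear operator. Define sequences Φ, Ψ : ℕ → H by Φ_{n+1} = (1/2)·S(Φ_n) − (id − S²/4)(Ψ_n) and Ψ_{n+1} = (1/2)·S(Ψ_n) + Φ_n. Then the energy E_n = ‖Φ_n‖² + ⟨Ψ_n, (id − S²/4)(Ψ_n)⟩ is constant: E_n = E_0 for all n ∈ ℕ. -/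
open scoped RealInnerProductSpace

/-- One step of `(a, b) ↦ (T a - (1 - T²) b, T b + a)` with `T` symmetric preserves
`‖a‖² + ⟪b, (1 - T²) b⟫`. -/
theorem LinearMap.IsSymmetric.energy_step {E : Type*} [NormedAddCommGroup E]
    [InnerProductSpace ℝ E] {T : E →ₗ[ℝ] E} (hT : T.IsSymmetric) (a b : E) :
    ‖T a - (b - T (T b))‖ ^ 2 + ⟪T b + a, (T b + a) - T (T (T b + a))⟫
      = ‖a‖ ^ 2 + ⟪b, b - T (T b)⟫ := by
  have hT' (x y : E) : ⟪T x, y⟫ = ⟪x, T y⟫ := hT x y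
  simp only [← real_inner_self_eq_norm_sq, map_add, inner_add_left, inner_add_right,
    inner_sub_left, inner_sub_right, hT']
  have h₁ : ⟪b, T a⟫ = ⟪a, T b⟫ := by rw [← hT', real_inner_comm]
  have h₃ : ⟪b, T (T (T a))⟫ = ⟪a, T (T (T b))⟫ := by
    rw [← hT', ← hT', ← hT', real_inner_comm]
  rw [h₁, h₃]
  ring

/-- Energy conservation for the p-adic wave equation: for a bounded self-adjoint operator `S`
on a real Hilbert space, the propagation `Φ_{n+1} = (1/2)S Φ_n − (1 − S²/4) Ψ_n`,
`Ψ_{n+1} = (1/2)S Ψ_n + Φ_n` preserves `‖Φ_n‖² + ⟪Ψ_n, (1 − S²/4) Ψ_n⟫`. -/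
theorem stmt_3 (H : Type*) [NormedAddCommGroup H] [InnerProductSpace ℝ H] [CompleteSpace H]
    (S : H →L[ℝ] H) (hS : IsSelfAdjoint S) (Φ Ψ : ℕ → H)
    (hΦ : ∀ n : ℕ, Φ (n + 1) =
      ((1 / 2 : ℝ) • S) (Φ n) - ((1 - (1 / 4 : ℝ) • S ^ 2 : H →L[ℝ] H)) (Ψ n))
    (hΨ : ∀ n : ℕ, Ψ (n + 1) = ((1 / 2 : ℝ) • S) (Ψ n) + Φ n) :
    ∀ n : ℕ,
      ‖Φ n‖ ^ 2 + ⟪Ψ n, ((1 - (1 / 4 : ℝ) • S ^ 2 : H →L[ℝ] H)) (Ψ n)⟫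
        = ‖Φ 0‖ ^ 2 + ⟪Ψ 0, ((1 - (1 / 4 : ℝ) • S ^ 2 : H →L[ℝ] H)) (Ψ 0)⟫ := by
  have hT : (((1 / 2 : ℝ) • S : H →L[ℝ] H) : H →ₗ[ℝ] H).IsSymmetric :=
    ((IsSelfAdjoint.all (1 / 2 : ℝ)).smul hS).isSymmetric
  have hK (x : H) : (1 - (1 / 4 : ℝ) • S ^ 2 : H →L[ℝ] H) x
      = x - ((1 / 2 : ℝ) • S) (((1 / 2 : ℝ) • S) x) := by
    simp [pow_two, smul_smul]
    norm_num
  intro n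
  induction n with
  | zero => rfl
  | succ n ih =>
    rw [← ih, hΦ, hΨ]
    simp only [hK]
    exact hT.energy_step (Φ n) (Ψ n)
end

section
/- Let η ∈ (0, 1/2), let Q be a positive integer with Qη > 64, let θ_0 ∈ ℝ, and let q be an integer with 1 ≤ q ≤ Q such that |qθ_0 − 2πm| < 2π/Q for some integer m. Then there exists an even positive integer q′ which is a multiple of q, satisfying Qη/64 ≤ q′ ≤ 2Q, 2q′/(2q) < Qη/32 · (1/q) · q (i.e. q′/q < Qη/32), and such that |q′θ_0 − 2πm′| < πη/16 for some integer m′. -/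
open Real

/-- Even-multiple refinement of Dirichlet approximation: from `q ≤ Q` with `qθ₀` within
`2π/Q` of `2πℤ`, produce an even multiple `q′` of `q` with `Qη/64 ≤ q′ ≤ 2Q`,
`q′/q < Qη/32`, and `q′θ₀` within `πη/16` of `2πℤ`. -/
theorem stmt_6 (η : ℝ) (hη : 0 < η ∧ η < 1 / 2) (Q : ℕ) (hQ : 0 < Q)
    (hQη : 64 < (Q : ℝ) * η) (θ0 : ℝ) (q : ℕ) (hq1 : 1 ≤ q) (hqQ : q ≤ Q)
    (happrox : ∃ m : ℤ, |(q : ℝ) * θ0 - 2 * π * m| < 2 * π / Q) :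
    ∃ q' : ℕ, 0 < q' ∧ Even q' ∧ q ∣ q' ∧
      (Q : ℝ) * η / 64 ≤ (q' : ℝ) ∧ (q' : ℝ) ≤ 2 * Q ∧
      (q' : ℝ) / (q : ℝ) < (Q : ℝ) * η / 32 ∧
      ∃ m' : ℤ, |(q' : ℝ) * θ0 - 2 * π * m'| < π * η / 16 := by
  obtain ⟨hη0, hη1⟩ := hη
  obtain ⟨m, hm⟩ := happrox
  have hQR : (0 : ℝ) < Q := by exact_mod_cast hQ
  have hq1R : (1 : ℝ) ≤ q := by exact_mod_cast hq1
  have hqQR : (q : ℝ) ≤ Q := by exact_mod_cast hqQ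
  have hq0 : (0 : ℝ) < q := by linarith
  obtain ⟨l, hl, hlx, hlq, hlQ⟩ : ∃ l : ℕ, 0 < l ∧ 2 * (l : ℝ) < Q * η / 32 ∧
      Q * η / 128 ≤ l * (q : ℝ) ∧ l * (q : ℝ) ≤ Q := by
    rcases le_or_gt ((Q : ℝ) * η / 128) q with h | h
    · exact ⟨1, one_pos, by push_cast; linarith, by simpa using h, by simpa using hqQR⟩
    · have hy : 0 < Q * η / 128 / (q : ℝ) := by positivity
      have hceil := Nat.ceil_lt_add_one hy.le
      have hdiv : Q * η / 128 / (q : ℝ) ≤ Q * η / 128 := div_le_self (by positivity) hq1R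
      refine ⟨⌈Q * η / 128 / (q : ℝ)⌉₊, Nat.ceil_pos.2 hy, by linarith,
        (div_le_iff₀ hq0).1 (Nat.le_ceil _), ?_⟩
      have hmul := mul_lt_mul_of_pos_right hceil hq0
      rw [add_mul, div_mul_cancel₀ _ hq0.ne'] at hmul
      nlinarith
  have hl0 : (0 : ℝ) < 2 * l := by positivity
  refine ⟨2 * l * q, by positivity, (even_two_mul l).mul_right q, dvd_mul_left q _, ?_, ?_, ?_,
    2 * l * m, ?_⟩
  · push_cast; linarith
  · push_cast; linarith
  · push_cast
    rwa [mul_div_cancel_right₀ _ hq0.ne']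
  · push_cast
    calc |2 * (l : ℝ) * q * θ0 - 2 * π * (2 * l * m)|
        = 2 * l * |(q : ℝ) * θ0 - 2 * π * m| := by
          rw [← abs_of_pos hl0, ← abs_mul, abs_of_pos hl0]
          ring_nf
      _ < 2 * l * (2 * π / Q) := mul_lt_mul_of_pos_left hm hl0
      _ ≤ Q * η / 32 * (2 * π / Q) := by gcongr
      _ = π * η / 16 := by
          field_simp
          norm_num
end

section
/- For all real numbers r and T, ∫_{−∞}^{∞} cos(ru)·(4·cosh(u)·cosh(T))/(cosh(2u) + cosh(2T)) du = 2π·cos(rT)/cosh(πr/2). -/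
open Real MeasureTheory

lemma hasDerivAt_exp_div_two_cosh (v : ℝ) :
    HasDerivAt (fun v ↦ Real.exp v / (2 * Real.cosh v)) (1 / (2 * Real.cosh v ^ 2)) v := by
  have hc := (Real.cosh_pos v).ne'
  refine ((Real.hasDerivAt_exp v).div ((Real.hasDerivAt_cosh v).const_mul 2)
    (by positivity)).congr_deriv ?_
  have h1 : Real.exp v * (Real.cosh v - Real.sinh v) = 1 := by
    rw [Real.cosh_sub_sinh, ← Real.exp_add]; simp
  field_simp
  linear_combination h1

lemma one_sub_exp_div_two_cosh (v : ℝ) :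
    1 - Real.exp v / (2 * Real.cosh v) = Real.exp (-v) / (2 * Real.cosh v) := by
  have hc := (Real.cosh_pos v).ne'
  have h := Real.cosh_eq v
  field_simp
  linarith

lemma injective_exp_div_two_cosh :
    Function.Injective (fun v ↦ Real.exp v / (2 * Real.cosh v)) := by
  refine (strictMono_of_deriv_pos fun v ↦ ?_).injective
  rw [(hasDerivAt_exp_div_two_cosh v).deriv]
  have := Real.cosh_pos v
  positivity

lemma image_univ_exp_div_two_cosh :
    (fun v ↦ Real.exp v / (2 * Real.cosh v)) '' Set.univ = Set.Ioo 0 1 := by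
  ext x
  simp only [Set.image_univ, Set.mem_range, Set.mem_Ioo]
  constructor
  · rintro ⟨v, rfl⟩
    have hc := Real.cosh_pos v
    have h := one_sub_exp_div_two_cosh v
    have : 0 < Real.exp (-v) / (2 * Real.cosh v) := by positivity
    exact ⟨by positivity, by linarith⟩
  · rintro ⟨h0, h1⟩
    have hx : 0 < 1 - x := by linarith
    refine ⟨Real.log (x / (1 - x)) / 2, ?_⟩
    set v := Real.log (x / (1 - x)) / 2 with hv
    have h2 : Real.exp v * Real.exp v = x / (1 - x) := by
      rw [← Real.exp_add, hv, add_halves, Real.exp_log (by positivity)]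
    have h3 : Real.exp v * Real.exp (-v) = 1 := by rw [← Real.exp_add]; simp
    rw [eq_div_iff hx.ne'] at h2
    have hc := Real.cosh_pos v
    rw [div_eq_iff (by positivity), Real.cosh_eq]
    have he := Real.exp_pos v
    apply mul_left_cancel₀ he.ne'
    linear_combination h2 - x * h3

lemma betaIntegrand_exp_div_two_cosh (r v : ℝ) :
    |1 / (2 * Real.cosh v ^ 2)| •
      (((Real.exp v / (2 * Real.cosh v) : ℝ) : ℂ) ^ ((1 / 2 + r / 2 * Complex.I : ℂ) - 1) *
        (1 - ((Real.exp v / (2 * Real.cosh v) : ℝ) : ℂ)) ^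
          ((1 - (1 / 2 + r / 2 * Complex.I) : ℂ) - 1)) =
      Complex.exp ((r * v : ℝ) * Complex.I) / (Real.cosh v : ℂ) := by
  have hc := Real.cosh_pos v
  have h2c : 0 < 2 * Real.cosh v := by positivity
  have hcC : (Real.cosh v : ℂ) ≠ 0 := by exact_mod_cast hc.ne'
  have hsub : (1 : ℂ) - ((Real.exp v / (2 * Real.cosh v) : ℝ) : ℂ) =
      ((Real.exp (-v) / (2 * Real.cosh v) : ℝ) : ℂ) := by
    rw [← one_sub_exp_div_two_cosh]; push_cast; rfl
  have hpos (w : ℝ) : 0 < Real.exp w / (2 * Real.cosh v) := by positivity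
  rw [hsub, Complex.cpow_def_of_ne_zero (by exact_mod_cast (hpos v).ne'),
    Complex.cpow_def_of_ne_zero (by exact_mod_cast (hpos (-v)).ne'),
    ← Complex.ofReal_log (hpos v).le, ← Complex.ofReal_log (hpos (-v)).le,
    Real.log_div (Real.exp_pos _).ne' h2c.ne', Real.log_div (Real.exp_pos _).ne' h2c.ne',
    Real.log_exp, Real.log_exp, ← Complex.exp_add, abs_of_pos (by positivity),
    Complex.real_smul]
  have hK : Complex.exp ((Real.log (2 * Real.cosh v) : ℝ) : ℂ) = 2 * (Real.cosh v : ℂ) := by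
    rw [← Complex.ofReal_exp, Real.exp_log h2c]; push_cast; rfl
  rw [show (((v - Real.log (2 * Real.cosh v) : ℝ) : ℂ) * (1 / 2 + r / 2 * Complex.I - 1) +
      ((-v - Real.log (2 * Real.cosh v) : ℝ) : ℂ) * (1 - (1 / 2 + r / 2 * Complex.I) - 1)) =
      (r * v : ℝ) * Complex.I + ((Real.log (2 * Real.cosh v) : ℝ) : ℂ) by
    simp only [Complex.ofReal_sub, Complex.ofReal_neg, Complex.ofReal_mul]; ring,
    Complex.exp_add, hK]
  simp only [Complex.ofReal_div, Complex.ofReal_mul, Complex.ofReal_pow, Complex.ofReal_one,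
    Complex.ofReal_ofNat]
  field_simp

lemma integrable_cexp_div_cosh (r : ℝ) :
    Integrable fun v : ℝ ↦ Complex.exp ((r * v : ℝ) * Complex.I) / (Real.cosh v : ℂ) := by
  have h := Complex.betaIntegral_convergent (u := 1 / 2 + r / 2 * Complex.I)
    (v := 1 - (1 / 2 + r / 2 * Complex.I)) (by simp) (by norm_num)
  rw [intervalIntegrable_iff_integrableOn_Ioo_of_le zero_le_one,
    ← image_univ_exp_div_two_cosh, integrableOn_image_iff_integrableOn_abs_deriv_smul
      MeasurableSet.univ (fun v _ ↦ (hasDerivAt_exp_div_two_cosh v).hasDerivWithinAt)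
      injective_exp_div_two_cosh.injOn, integrableOn_univ] at h
  simpa only [betaIntegrand_exp_div_two_cosh] using h

lemma integral_cexp_div_cosh (r : ℝ) :
    ∫ v : ℝ, Complex.exp ((r * v : ℝ) * Complex.I) / (Real.cosh v : ℂ) =
      ((π / Real.cosh (π * r / 2) : ℝ) : ℂ) := by
  have h := Complex.Gamma_mul_Gamma_eq_betaIntegral (s := 1 / 2 + r / 2 * Complex.I)
    (t := 1 - (1 / 2 + r / 2 * Complex.I)) (by simp) (by norm_num)
  rw [add_sub_cancel, Complex.Gamma_one, one_mul, Complex.Gamma_mul_Gamma_one_sub,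
    Complex.betaIntegral, intervalIntegral.integral_of_le zero_le_one,
    integral_Ioc_eq_integral_Ioo, ← image_univ_exp_div_two_cosh,
    integral_image_eq_integral_abs_deriv_smul
      MeasurableSet.univ (fun v _ ↦ (hasDerivAt_exp_div_two_cosh v).hasDerivWithinAt)
      injective_exp_div_two_cosh.injOn, setIntegral_univ] at h
  simp only [betaIntegrand_exp_div_two_cosh] at h
  rw [← h, show (π : ℂ) * (1 / 2 + r / 2 * Complex.I) = (π * r / 2) * Complex.I + π / 2 by ring,
    Complex.sin_add_pi_div_two, Complex.cos_mul_I]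
  push_cast
  rfl

lemma re_cexp_div_cosh (r v : ℝ) :
    (Complex.exp ((r * v : ℝ) * Complex.I) / (Real.cosh v : ℂ)).re =
      Real.cos (r * v) / Real.cosh v := by
  rw [Complex.div_ofReal_re, Complex.exp_ofReal_mul_I_re]

lemma integral_cos_div_cosh (r : ℝ) :
    ∫ v : ℝ, Real.cos (r * v) / Real.cosh v = π / Real.cosh (π * r / 2) := by
  have h := integral_re (integrable_cexp_div_cosh r)
  rw [integral_cexp_div_cosh] at h
  simpa only [RCLike.re_to_complex, re_cexp_div_cosh, Complex.ofReal_re] using h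

lemma integrable_cos_add_div_cosh (r c : ℝ) :
    Integrable fun v : ℝ ↦ Real.cos (r * v + c) / Real.cosh v := by
  have h := ((integrable_cexp_div_cosh r).mul_const (Complex.exp (c * Complex.I))).re
  refine h.congr (.of_forall fun v ↦ ?_)
  change (_ : ℂ).re = _
  rw [div_mul_eq_mul_div, ← Complex.exp_add, ← add_mul, ← Complex.ofReal_add,
    Complex.div_ofReal_re, Complex.exp_ofReal_mul_I_re]

lemma cosh_mul_cosh_div_cosh_add_cosh (u T : ℝ) :
    4 * Real.cosh u * Real.cosh T / (Real.cosh (2 * u) + Real.cosh (2 * T)) =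
      1 / Real.cosh (u - T) + 1 / Real.cosh (u + T) := by
  have h1 := Real.cosh_pos (u - T)
  have h2 := Real.cosh_pos (u + T)
  have h3 : Real.cosh (2 * u) + Real.cosh (2 * T) =
      2 * (Real.cosh (u - T) * Real.cosh (u + T)) := by
    rw [show 2 * u = (u - T) + (u + T) by ring, show 2 * T = (u + T) - (u - T) by ring,
      Real.cosh_add (u - T), Real.cosh_sub (u + T)]
    ring
  have h4 : 4 * Real.cosh u * Real.cosh T = 2 * (Real.cosh (u - T) + Real.cosh (u + T)) := by
    rw [Real.cosh_add, Real.cosh_sub]; ring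
  rw [h3, h4]
  field_simp
  ring

/-- The Fourier transform pair underlying the Selberg/Harish-Chandra kernel:
`∫ cos(ru)·4cosh(u)cosh(T)/(cosh(2u)+cosh(2T)) du = 2π cos(rT)/cosh(πr/2)`. -/
theorem stmt_9 (r T : ℝ) :
    ∫ u : ℝ, Real.cos (r * u) *
        (4 * Real.cosh u * Real.cosh T) / (Real.cosh (2 * u) + Real.cosh (2 * T))
      = 2 * π * Real.cos (r * T) / Real.cosh (π * r / 2) := by
  have hshift (c : ℝ) (u : ℝ) : Real.cos (r * (u + c) + -(r * c)) / Real.cosh (u + c) =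
      Real.cos (r * u) / Real.cosh (u + c) := by ring_nf
  have hint (c : ℝ) : Integrable fun u : ℝ ↦ Real.cos (r * u) / Real.cosh (u + c) := by
    simpa only [hshift] using (integrable_cos_add_div_cosh r (-(r * c))).comp_add_right c
  have heq (c : ℝ) : ∫ u : ℝ, Real.cos (r * u) / Real.cosh (u + c) =
      ∫ v : ℝ, Real.cos (r * v + -(r * c)) / Real.cosh v := by
    rw [← integral_add_right_eq_self (fun v ↦ Real.cos (r * v + -(r * c)) / Real.cosh v) c]
    simp only [hshift]
  have hsplit (u : ℝ) : Real.cos (r * u) * (4 * Real.cosh u * Real.cosh T) /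
      (Real.cosh (2 * u) + Real.cosh (2 * T)) =
      Real.cos (r * u) / Real.cosh (u + -T) + Real.cos (r * u) / Real.cosh (u + T) := by
    rw [mul_div_assoc, cosh_mul_cosh_div_cosh_add_cosh, ← sub_eq_add_neg]
    ring
  simp only [hsplit]
  rw [integral_add (hint _) (hint _), heq, heq, ← integral_add
    (integrable_cos_add_div_cosh _ _) (integrable_cos_add_div_cosh _ _)]
  have hsum (v : ℝ) : Real.cos (r * v + -(r * -T)) / Real.cosh v +
      Real.cos (r * v + -(r * T)) / Real.cosh v =
      2 * Real.cos (r * T) * (Real.cos (r * v) / Real.cosh v) := by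
    rw [mul_neg, neg_neg, ← sub_eq_add_neg, Real.cos_add, Real.cos_sub]
    ring
  simp only [hsum]
  rw [integral_const_mul, integral_cos_div_cosh]
  ring
end

section
/- There exists a constant C > 0 such that for every T ≥ 1 and every t ≥ cosh(T), |k_T(t)| ≤ C·cosh(T)·t^{−3/2}. -/
open Real MeasureTheory

/-- `Q_T(ω) = 2(4ω+2)cosh(T)/((4ω+2)² − 2 + 2cosh(2T))`. -/
noncomputable def QT (T ω : ℝ) : ℝ :=
  2 * (4 * ω + 2) * Real.cosh T / ((4 * ω + 2) ^ 2 - 2 + 2 * Real.cosh (2 * T))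

/-- The radial kernel with spherical transform `cos(rT)/cosh(πr/2)`:
`k_T(t) = −(1/π) ∫_t^∞ Q_T′(ω) (ω − t)^{−1/2} dω`. -/
noncomputable def kT (T t : ℝ) : ℝ :=
  -(1 / Real.pi) * ∫ ω in Set.Ioi t, deriv (QT T) ω / Real.sqrt (ω - t)

lemma abs_deriv_QT_le (T : ℝ) {ω : ℝ} (hω : 0 < ω) :
    |deriv (QT T) ω| ≤ Real.cosh T / (2 * ω ^ 2) := by
  have ha : 1 ≤ Real.cosh (2 * T) := Real.one_le_cosh _
  have hc : 0 < Real.cosh T := Real.cosh_pos T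
  set a : ℝ := Real.cosh (2 * T) with ha_def
  set c : ℝ := Real.cosh T with hc_def
  have hx : HasDerivAt (fun y : ℝ => 4 * y + 2) 4 ω := by
    simpa using ((hasDerivAt_id ω).const_mul 4).add_const 2
  have hD : 0 < (4 * ω + 2) ^ 2 - 2 + 2 * a := by nlinarith
  have hnum := (hx.const_mul 2).mul_const c
  have hden := ((hx.pow 2).sub_const 2).add_const (2 * a)
  have hQ : HasDerivAt (QT T) _ ω := hnum.div hden hD.ne'
  rw [hQ.deriv, abs_div, abs_of_pos (pow_pos hD 2), div_le_div_iff₀ (pow_pos hD 2) (by positivity)]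
  have hle : 16 * ω ^ 2 ≤ (4 * ω + 2) ^ 2 - 2 + 2 * a := by nlinarith
  have habs : |2 * 4 * c * ((4 * ω + 2) ^ 2 - 2 + 2 * a) -
      2 * (4 * ω + 2) * c * (2 * (4 * ω + 2) * 4)| ≤
      8 * c * ((4 * ω + 2) ^ 2 - 2 + 2 * a) := by
    have h1 : 0 ≤ c * (2 * a - 2) := mul_nonneg hc.le (by linarith)
    have h2 : 0 ≤ c * (4 * ω + 2) ^ 2 := by positivity
    rw [abs_le]
    constructor <;> nlinarith
  calc _ = |2 * 4 * c * ((4 * ω + 2) ^ 2 - 2 + 2 * a) -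
      2 * (4 * ω + 2) * c * (2 * (4 * ω + 2) * 4)| * (2 * ω ^ 2) := by
        congr 2
        simp [← ha_def]
    _ ≤ 8 * c * ((4 * ω + 2) ^ 2 - 2 + 2 * a) * (2 * ω ^ 2) := by gcongr
    _ = c * ((4 * ω + 2) ^ 2 - 2 + 2 * a) * (16 * ω ^ 2) := by ring
    _ ≤ c * ((4 * ω + 2) ^ 2 - 2 + 2 * a) * ((4 * ω + 2) ^ 2 - 2 + 2 * a) := by gcongr
    _ = _ := by ring

lemma hasDerivAt_sqrt_one_sub_div {t ω : ℝ} (ht : 0 < t) (hω : t < ω) :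
    HasDerivAt (fun y => √(1 - t / y)) (t / ω ^ 2 / (2 * √(1 - t / ω))) ω := by
  have h0 : 0 < ω := ht.trans hω
  have hpos : 0 < 1 - t / ω := by
    rw [sub_pos, div_lt_one h0]
    exact hω
  have h := (((hasDerivAt_inv h0.ne').const_mul t).const_sub 1).sqrt (by
    simpa [div_eq_mul_inv] using hpos.ne')
  simpa [div_eq_mul_inv] using h

lemma integral_deriv_sqrt_one_sub_div {t : ℝ} (ht : 0 < t) :
    IntegrableOn (fun ω => t / ω ^ 2 / (2 * √(1 - t / ω))) (Set.Ioi t) ∧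
      ∫ ω in Set.Ioi t, t / ω ^ 2 / (2 * √(1 - t / ω)) = 1 := by
  have hcont : ContinuousWithinAt (fun y => √(1 - t / y)) (Set.Ici t) t := by
    apply ContinuousAt.continuousWithinAt
    have := ht.ne'
    fun_prop (disch := assumption)
  have hderiv : ∀ ω ∈ Set.Ioi t,
      HasDerivAt (fun y => √(1 - t / y)) (t / ω ^ 2 / (2 * √(1 - t / ω))) ω :=
    fun ω hω => hasDerivAt_sqrt_one_sub_div ht hω
  have hnonneg : ∀ ω ∈ Set.Ioi t, 0 ≤ t / ω ^ 2 / (2 * √(1 - t / ω)) :=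
    fun ω _ => by positivity
  have hlim : Filter.Tendsto (fun y => √(1 - t / y)) Filter.atTop (nhds 1) := by
    have h : Filter.Tendsto (fun y : ℝ => 1 - t / y) Filter.atTop (nhds (1 - 0)) :=
      (Filter.Tendsto.const_div_atTop Filter.tendsto_id t).const_sub 1
    simpa using h.sqrt
  refine ⟨integrableOn_Ioi_deriv_of_nonneg hcont hderiv hnonneg hlim, ?_⟩
  rw [integral_Ioi_of_hasDerivAt_of_nonneg hcont hderiv hnonneg hlim]
  simp [ht.ne']

lemma one_div_sq_div_sqrt_le {t ω : ℝ} (ht : 0 < t) (hω : t < ω) :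
    1 / (2 * ω ^ 2) / √(ω - t) ≤
      t ^ (-(3 / 2) : ℝ) * (t / ω ^ 2 / (2 * √(1 - t / ω))) := by
  have h0 : 0 < ω := ht.trans hω
  have hs : 0 < √t := Real.sqrt_pos.2 ht
  have hr : 0 < √(ω - t) := Real.sqrt_pos.2 (sub_pos.2 hω)
  have hpow : t ^ (-(3 / 2) : ℝ) = 1 / (t * √t) := by
    rw [Real.rpow_neg ht.le, show (3 / 2 : ℝ) = 1 + 1 / 2 by norm_num, Real.rpow_add ht,
      Real.rpow_one, ← Real.sqrt_eq_rpow, one_div]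
  have hsqrt : √(1 - t / ω) = √(ω - t) / √ω := by
    rw [← Real.sqrt_div (sub_pos.2 hω).le]
    congr 1
    field_simp
  have hw : 0 < √ω := Real.sqrt_pos.2 h0
  have hle : √t ≤ √ω := Real.sqrt_le_sqrt hω.le
  rw [hpow, hsqrt]
  calc 1 / (2 * ω ^ 2) / √(ω - t) = 1 / (2 * ω ^ 2) / √(ω - t) * 1 := by ring
    _ ≤ 1 / (2 * ω ^ 2) / √(ω - t) * (√ω / √t) := by
        gcongr
        rwa [one_le_div hs]
    _ = _ := by field_simp

/-- For `T ≥ 1` and `t ≥ cosh T`, `|k_T(t)| ≤ C cosh(T) t^{−3/2}`. -/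
theorem stmt_12 :
    ∃ C : ℝ, 0 < C ∧ ∀ T : ℝ, 1 ≤ T → ∀ t : ℝ, Real.cosh T ≤ t →
      |kT T t| ≤ C * Real.cosh T * t ^ (-(3 / 2) : ℝ) := by
  refine ⟨1 / π, by positivity, fun T _ t hTt => ?_⟩
  have hc : 0 < Real.cosh T := Real.cosh_pos T
  have ht : 0 < t := hc.trans_le hTt
  obtain ⟨hint, hval⟩ := integral_deriv_sqrt_one_sub_div ht
  have hbound : ‖∫ ω in Set.Ioi t, deriv (QT T) ω / √(ω - t)‖ ≤
      ∫ ω in Set.Ioi t,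
        Real.cosh T * t ^ (-(3 / 2) : ℝ) * (t / ω ^ 2 / (2 * √(1 - t / ω))) := by
    refine norm_integral_le_of_norm_le (hint.const_mul _) ?_
    refine (ae_restrict_iff' measurableSet_Ioi).2 (Filter.Eventually.of_forall fun ω hω => ?_)
    have hω' : t < ω := hω
    rw [Real.norm_eq_abs, abs_div, abs_of_nonneg (Real.sqrt_nonneg _)]
    calc |deriv (QT T) ω| / √(ω - t) ≤ Real.cosh T / (2 * ω ^ 2) / √(ω - t) := by
          gcongr
          exact abs_deriv_QT_le T (ht.trans hω')
      _ = Real.cosh T * (1 / (2 * ω ^ 2) / √(ω - t)) := by ring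
      _ ≤ Real.cosh T * (t ^ (-(3 / 2) : ℝ) * (t / ω ^ 2 / (2 * √(1 - t / ω)))) :=
          mul_le_mul_of_nonneg_left (one_div_sq_div_sqrt_le ht hω') hc.le
      _ = _ := by ring
  rw [integral_const_mul, hval, mul_one, Real.norm_eq_abs] at hbound
  rw [kT, abs_mul, abs_neg, abs_of_pos (by positivity : 0 < 1 / π), mul_assoc]
  gcongr
end

section
/- There exists a constant C > 0 depending only on p such that for every vertex x, all positive integers q and L, and every finitely supported function f : V → ℝ: ((Σ_{l=1}^{L} P_{2ql}(T_p/2)) f)(x)² ≤ C·L·Σ_{y : d(x,y) ≤ 2qL} f(y)². -/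
open Polynomial

namespace SimpleGraph

variable {V : Type*} {G : SimpleGraph V}

/-- In a tree, a vertex `x ≠ y` has exactly one neighbor closer to `y`. -/
lemma IsTree.existsUnique_adj_dist_eq (hG : G.IsTree) {x y : V} {n : ℕ}
    (h : G.dist x y = n + 1) : ∃! z, G.Adj x z ∧ G.dist z y = n := by
  obtain ⟨w, hw⟩ := hG.connected.exists_walk_length_eq_dist x y
  cases w with
  | nil => simp at h
  | @cons _ z _ hxz w =>
    rw [h, Walk.length_cons, Nat.add_right_cancel_iff] at hw
    have hle : G.dist z y ≤ n := hw ▸ dist_le w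
    have htri : G.dist x y ≤ G.dist x z + G.dist z y := hG.connected.dist_triangle
    rw [dist_eq_one_iff_adj.2 hxz] at htri
    refine ⟨z, ⟨hxz, by omega⟩, ?_⟩
    rintro z' ⟨hxz', hz'⟩
    obtain ⟨w', hw'⟩ := hG.connected.exists_walk_length_eq_dist z' y
    have hp : (Walk.cons hxz w).IsPath := Walk.isPath_of_length_eq_dist _ (by simp [hw, h])
    have hp' : (Walk.cons hxz' w').IsPath :=
      Walk.isPath_of_length_eq_dist _ (by simp [hw', hz', h])
    have := (hG.existsUnique_path x y).unique hp' hp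
    simp only [Walk.cons.injEq] at this
    exact this.1

variable [∀ v, Fintype (G.neighborSet v)] {p : ℕ}

/-- Summing a radial function around `y` over the neighbors of a vertex other than `y`. -/
lemma IsTree.sum_neighborFinset_dist (hG : G.IsTree) (hdeg : ∀ v, G.degree v = p + 1)
    {R : Type*} [CommSemiring R] (g : ℕ → R) {x y : V} {n : ℕ} (h : G.dist x y = n + 1) :
    ∑ z ∈ G.neighborFinset x, g (G.dist z y) = g n + p * g (n + 2) := by
  classical
  obtain ⟨z₀, ⟨hadj, hz₀⟩, huniq⟩ := hG.existsUnique_adj_dist_eq h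
  have hmem : z₀ ∈ G.neighborFinset x := by simpa using hadj
  rw [← Finset.add_sum_erase _ _ hmem, hz₀, Finset.sum_congr rfl (g := fun _ => g (n + 2)),
    Finset.sum_const, Finset.card_erase_of_mem hmem, card_neighborFinset_eq_degree, hdeg]
  · simp
  · intro z hz
    rw [Finset.mem_erase, mem_neighborFinset] at hz
    have hne : G.dist z y ≠ n := fun hzn => hz.1 (huniq z ⟨hz.2, hzn⟩)
    have := hG.dist_eq_dist_add_one_of_adj y hz.2
    rw [dist_comm (u := y), dist_comm (u := y), h] at this
    congr 1
    omega

lemma sum_neighborFinset_dist_self (hdeg : ∀ v, G.degree v = p + 1)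
    {R : Type*} [CommSemiring R] (g : ℕ → R) (x : V) :
    ∑ z ∈ G.neighborFinset x, g (G.dist z x) = (p + 1) * g 1 := by
  rw [Finset.sum_congr rfl (g := fun _ => g 1), Finset.sum_const,
    card_neighborFinset_eq_degree, hdeg]
  · simp
  · intro z hz
    rw [mem_neighborFinset] at hz
    rw [dist_eq_one_iff_adj.2 hz.symm]

lemma IsTree.exists_sphere (hG : G.IsTree) (hdeg : ∀ v, G.degree v = p + 1) (hp : 1 ≤ p)
    (x : V) (n : ℕ) :
    ∃ S : Finset V, (∀ y, y ∈ S ↔ G.dist x y = n) ∧ S.card ≤ 2 * p ^ n := by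
  classical
  induction n with
  | zero =>
    refine ⟨{x}, fun y => ?_, by simp⟩
    rw [Finset.mem_singleton, hG.connected.dist_eq_zero_iff, eq_comm]
  | succ n ih =>
    obtain ⟨S, hS, hcard⟩ := ih
    refine ⟨S.biUnion fun y => {z ∈ G.neighborFinset y | G.dist z x = n + 1}, fun z => ?_, ?_⟩
    · simp only [Finset.mem_biUnion, Finset.mem_filter, mem_neighborFinset, hS]
      refine ⟨fun ⟨y, _, _, hz⟩ => dist_comm.trans hz, fun hz => ?_⟩
      rw [dist_comm] at hz
      obtain ⟨y, ⟨hzy, hy⟩, -⟩ := hG.existsUnique_adj_dist_eq hz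
      exact ⟨y, dist_comm.trans hy, hzy.symm, hz⟩
    · have key (y : V) :
          ({z ∈ G.neighborFinset y | G.dist z x = n + 1} : Finset V).card =
            ∑ z ∈ G.neighborFinset y, if G.dist z x = n + 1 then 1 else 0 := by
        rw [Finset.card_filter]
      rcases n with _ | n
      · have hSx : S = {x} := by
          ext y
          rw [hS, Finset.mem_singleton, hG.connected.dist_eq_zero_iff, eq_comm]
        subst hSx
        rw [Finset.singleton_biUnion, key,
          sum_neighborFinset_dist_self hdeg (fun m => if m = 0 + 1 then 1 else 0)]
        simp
        omega
      · calc _ ≤ S.card * p := by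
              refine Finset.card_biUnion_le_card_mul _ _ _ fun y hy => ?_
              rw [hS, dist_comm] at hy
              rw [key, hG.sum_neighborFinset_dist hdeg
                (fun m => if m = n + 1 + 1 then 1 else 0) hy]
              simp [show n ≠ n + 1 + 1 by omega]
          _ ≤ 2 * p ^ (n + 1) * p := by gcongr
          _ = 2 * p ^ (n + 1 + 1) := by ring

lemma IsTree.card_filter_dist_le (hG : G.IsTree) (hdeg : ∀ v, G.degree v = p + 1) (hp : 2 ≤ p)
    (x : V) (n : ℕ) (F : Finset V) : {y ∈ F | G.dist x y ≤ n}.card ≤ 4 * p ^ n := by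
  classical
  induction n with
  | zero =>
    obtain ⟨S, hS, hcard⟩ := hG.exists_sphere hdeg (by omega) x 0
    refine (Finset.card_le_card (t := S) fun y hy => ?_).trans (hcard.trans (by simp))
    exact (hS y).2 (Nat.le_zero.1 (Finset.mem_filter.1 hy).2)
  | succ n ih =>
    obtain ⟨S, hS, hcard⟩ := hG.exists_sphere hdeg (by omega) x (n + 1)
    calc _ ≤ ({y ∈ F | G.dist x y ≤ n} ∪ S).card := by
          refine Finset.card_le_card fun y hy => ?_
          rw [Finset.mem_filter] at hy
          rw [Finset.mem_union, Finset.mem_filter, hS]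
          rcases Nat.le_or_eq_of_le_succ hy.2 with h | h
          · exact .inl ⟨hy.1, h⟩
          · exact .inr h
      _ ≤ 4 * p ^ n + 2 * p ^ (n + 1) := (Finset.card_union_le _ _).trans (by gcongr)
      _ ≤ 2 * p * p ^ n + 2 * p ^ (n + 1) := by gcongr; omega
      _ = 4 * p ^ (n + 1) := by ring

end SimpleGraph

/-- The radial kernel of `U_n(T_p / 2)` on the `(p+1)`-regular tree, with `s = p ^ (-1/2)`. -/
noncomputable def chebyshevUKernel (s : ℝ) (n d : ℕ) : ℝ :=
  if d ≤ n ∧ n % 2 = d % 2 then s ^ n else 0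

section Kernel

variable {p : ℕ} {s : ℝ}

lemma chebyshevUKernel_add_two_zero (hs : s ^ 2 * p = 1) (n : ℕ) :
    chebyshevUKernel s (n + 2) 0 =
      s * ((p + 1) * chebyshevUKernel s (n + 1) 1) - chebyshevUKernel s n 0 := by
  unfold chebyshevUKernel
  rcases Nat.mod_two_eq_zero_or_one n with h | h
  · rw [if_pos (by omega), if_pos (by omega), if_pos (by omega)]
    linear_combination (-s ^ n) * hs
  · rw [if_neg (by omega), if_neg (by omega), if_neg (by omega)]
    ring

lemma chebyshevUKernel_add_two_succ (hs : s ^ 2 * p = 1) (n d : ℕ) :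
    chebyshevUKernel s (n + 2) (d + 1) =
      s * (chebyshevUKernel s (n + 1) d + p * chebyshevUKernel s (n + 1) (d + 2)) -
        chebyshevUKernel s n (d + 1) := by
  unfold chebyshevUKernel
  by_cases h : n % 2 = (d + 1) % 2
  · by_cases h1 : d + 1 ≤ n
    · rw [if_pos (by omega), if_pos (by omega), if_pos (by omega), if_pos (by omega)]
      linear_combination (-s ^ n) * hs
    · by_cases h2 : d + 1 ≤ n + 2
      · rw [if_pos (by omega), if_pos (by omega), if_neg (by omega), if_neg (by omega)]
        ring
      · rw [if_neg (by omega), if_neg (by omega), if_neg (by omega), if_neg (by omega)]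
        ring
  · rw [if_neg (by omega), if_neg (by omega), if_neg (by omega), if_neg (by omega)]
    ring

variable {V : Type*} {G : SimpleGraph V} [∀ v, Fintype (G.neighborSet v)]

lemma aeval_chebyshev_U_apply (hG : G.IsTree) (hdeg : ∀ v, G.degree v = p + 1)
    (hs : s ^ 2 * p = 1) {T : Module.End ℝ (V → ℝ)}
    (hT : ∀ f x, T f x = s * ∑ y ∈ G.neighborFinset x, f y)
    {f : V → ℝ} {F : Finset V} (hF : Function.support f ⊆ F) (n : ℕ) (x : V) :
    aeval ((1 / 2 : ℝ) • T) (Chebyshev.U ℝ n) f x =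
      ∑ y ∈ F, chebyshevUKernel s n (G.dist x y) * f y := by
  classical
  have hT' {k : ℕ → ℝ} {h : V → ℝ} (hh : ∀ x, h x = ∑ y ∈ F, k (G.dist x y) * f y) (x : V) :
      T h x = ∑ y ∈ F, s * (∑ z ∈ G.neighborFinset x, k (G.dist z y)) * f y := by
    simp_rw [hT, hh, Finset.mul_sum, Finset.sum_mul, mul_assoc]
    exact Finset.sum_comm
  have hzero (x : V) : f x = ∑ y ∈ F, chebyshevUKernel s 0 (G.dist x y) * f y := by
    have (y : V) : chebyshevUKernel s 0 (G.dist x y) * f y = if x = y then f y else 0 := by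
      rw [chebyshevUKernel]
      by_cases hxy : x = y
      · simp [hxy]
      · have := hG.connected.pos_dist_of_ne hxy
        rw [if_neg (by omega), if_neg hxy, zero_mul]
    simp_rw [this, Finset.sum_ite_eq]
    split_ifs with hx
    · rfl
    · by_contra h
      exact hx (hF h)
  have htwo : aeval ((1 / 2 : ℝ) • T) (2 * X : ℝ[X]) = T := by
    rw [map_mul, aeval_X, map_ofNat, two_mul, ← add_smul]
    norm_num
  induction n using Nat.twoStepInduction generalizing x with
  | zero => simpa using hzero x
  | one =>
    rw [Nat.cast_one, Chebyshev.U_one, htwo, hT' hzero]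
    refine Finset.sum_congr rfl fun y _ => ?_
    congr 1
    rcases hd : G.dist x y with _ | d
    · obtain rfl := hG.connected.dist_eq_zero_iff.1 hd
      rw [SimpleGraph.sum_neighborFinset_dist_self hdeg]
      simp [chebyshevUKernel]
    · rw [hG.sum_neighborFinset_dist hdeg _ hd]
      rcases d with _ | d <;> simp [chebyshevUKernel]
  | more n ih₀ ih₁ =>
    rw [Nat.cast_add, Nat.cast_two, Chebyshev.U_add_two, map_sub, map_mul, htwo,
      LinearMap.sub_apply, Pi.sub_apply, Module.End.mul_apply, ih₀]
    rw [hT' (k := chebyshevUKernel s (n + 1)) (fun x => by exact_mod_cast ih₁ x),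
      ← Finset.sum_sub_distrib]
    refine Finset.sum_congr rfl fun y _ => ?_
    rw [← sub_mul]
    congr 1
    rcases hd : G.dist x y with _ | d
    · obtain rfl := hG.connected.dist_eq_zero_iff.1 hd
      rw [SimpleGraph.sum_neighborFinset_dist_self hdeg, chebyshevUKernel_add_two_zero hs]
    · rw [hG.sum_neighborFinset_dist hdeg _ hd, chebyshevUKernel_add_two_succ hs]

lemma abs_chebyshevUKernel_sub_le (hs : s ^ 2 * p = 1) (hp : 1 ≤ p) (hs0 : 0 ≤ s) (n d : ℕ) :
    |2⁻¹ * (chebyshevUKernel s (n + 2) d - chebyshevUKernel s n d)| ≤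
      if d ≤ n + 2 then p * s ^ (n + 2) else 0 := by
  have hp' : (1 : ℝ) ≤ p := by exact_mod_cast hp
  have hpow : (0 : ℝ) ≤ s ^ (n + 2) := by positivity
  have hn : s ^ n = p * s ^ (n + 2) := by linear_combination (-s ^ n) * hs
  have hpp : s ^ (n + 2) ≤ p * s ^ (n + 2) := le_mul_of_one_le_left hpow hp'
  unfold chebyshevUKernel
  rw [hn, abs_le]
  split_ifs <;> first | omega | (constructor <;> linarith)

/-- The kernel of `P_n(T_p / 2)` for `n ≥ 2` is supported on the ball of radius `n`
and bounded by `p * p ^ (-n/2)`. -/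
lemma exists_kernel_aeval_chebyshev_T (hG : G.IsTree) (hdeg : ∀ v, G.degree v = p + 1)
    (hp : 1 ≤ p) (hs : s ^ 2 * p = 1) (hs0 : 0 ≤ s) {T : Module.End ℝ (V → ℝ)}
    (hT : ∀ f x, T f x = s * ∑ y ∈ G.neighborFinset x, f y) {n : ℕ} (hn : 2 ≤ n) :
    ∃ k : ℕ → ℝ, (∀ d, |k d| ≤ if d ≤ n then p * s ^ n else 0) ∧
      ∀ (f : V → ℝ) (F : Finset V), Function.support f ⊆ F → ∀ x,
        aeval ((1 / 2 : ℝ) • T) (Chebyshev.T ℝ n) f x = ∑ y ∈ F, k (G.dist x y) * f y := by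
  obtain ⟨n, rfl⟩ := Nat.exists_eq_add_of_le' hn
  refine ⟨_, abs_chebyshevUKernel_sub_le hs hp hs0 n, fun f F hF x => ?_⟩
  have h := congrArg (fun P => aeval ((1 / 2 : ℝ) • T) P f x) (Chebyshev.two_mul_T_eq_U_sub_U ℝ n)
  have h₂ := aeval_chebyshev_U_apply hG hdeg hs hT hF (n + 2) x
  push_cast at h₂ ⊢
  simp only [two_mul, map_add, map_sub, LinearMap.add_apply, LinearMap.sub_apply, Pi.add_apply,
    Pi.sub_apply, h₂, aeval_chebyshev_U_apply hG hdeg hs hT hF n x,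
    ← Finset.sum_sub_distrib] at h
  simp only [mul_assoc, ← Finset.mul_sum, sub_mul]
  linarith

end Kernel

lemma sq_sum_pow_le {r : ℝ} (h0 : 0 ≤ r) (hr : r ≤ 1 / 2) (s : Finset ℕ) :
    (∑ l ∈ s, r ^ l) ^ 2 ≤ 4 * ∑ l ∈ s, (r ^ l) ^ 2 := by
  rcases s.eq_empty_or_nonempty with rfl | hs
  · simp
  set m := s.min' hs
  have hle : ∑ l ∈ s, r ^ l ≤ 2 * r ^ m := by
    calc ∑ l ∈ s, r ^ l ≤ ∑ l ∈ Finset.Ico m (s.max' hs + 1), r ^ l := by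
          refine Finset.sum_le_sum_of_subset_of_nonneg (fun l hl => ?_) fun _ _ _ => by positivity
          exact Finset.mem_Ico.2 ⟨s.min'_le l hl, Nat.lt_succ_of_le (s.le_max' l hl)⟩
      _ ≤ r ^ m / (1 - r) := geom_sum_Ico_le_of_lt_one h0 (by linarith)
      _ ≤ 2 * r ^ m := by
          rw [div_le_iff₀ (by linarith)]
          nlinarith [pow_nonneg h0 m]
  calc (∑ l ∈ s, r ^ l) ^ 2 ≤ (2 * r ^ m) ^ 2 :=
        pow_le_pow_left₀ (Finset.sum_nonneg fun _ _ => by positivity) hle 2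
    _ = 4 * (r ^ m) ^ 2 := by ring
    _ ≤ 4 * ∑ l ∈ s, (r ^ l) ^ 2 := by
        gcongr
        exact Finset.single_le_sum (f := fun l => (r ^ l) ^ 2) (fun _ _ => by positivity)
          (s.min'_mem hs)

/-- Cauchy–Schwarz propagation estimate on the (p+1)-regular tree: there is a constant
`C > 0` depending only on `p` such that for every (p+1)-regular tree, every vertex `x`,
all positive integers `q, L`, and every finitely supported `f : V → ℝ`,
`((Σ_{l=1}^L P_{2ql}(T_p/2)) f)(x)² ≤ C L Σ_{y : d(x,y) ≤ 2qL} f(y)²`. -/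
theorem stmt_16 (p : ℕ) (hp : 2 ≤ p) :
    ∃ C : ℝ, 0 < C ∧
      ∀ (V : Type) (G : SimpleGraph V) (inst : ∀ v : V, Fintype (G.neighborSet v)),
        G.Connected → G.IsAcyclic →
        (∀ v : V, @SimpleGraph.degree V G v (inst v) = p + 1) →
        ∀ (Tp : Module.End ℝ (V → ℝ)),
          (∀ (f : V → ℝ) (x : V),
            Tp f x = (Real.sqrt p)⁻¹ *
              ∑ y ∈ @SimpleGraph.neighborFinset V G x (inst x), f y) →
          ∀ (x : V) (q L : ℕ), 0 < q → 0 < L →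
            ∀ (f : V → ℝ) (hf : (Function.support f).Finite),
              ((∑ l ∈ Finset.Icc 1 L,
                  Polynomial.aeval ((1 / 2 : ℝ) • Tp)
                    (Polynomial.Chebyshev.T ℝ (2 * q * l))) f x) ^ 2
                ≤ C * L *
                  ∑ y ∈ hf.toFinset.filter (fun y => G.dist x y ≤ 2 * q * L),
                    (f y) ^ 2 := by
  refine ⟨16 * (p : ℝ) ^ 2, by positivity, ?_⟩
  intro V G inst hconn hacyc hdeg Tp hT x q L hq _ f hf
  have hG : G.IsTree := ⟨hconn, hacyc⟩
  set s : ℝ := (Real.sqrt p)⁻¹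
  have hs0 : 0 ≤ s := by positivity
  have hs : s ^ 2 * p = 1 := by
    rw [inv_pow, Real.sq_sqrt (by positivity)]
    exact inv_mul_cancel₀ (by positivity)
  have hp2 : (2 : ℝ) ≤ p := by exact_mod_cast hp
  have hss : s ^ 2 ≤ 1 / 2 := by nlinarith [sq_nonneg s]
  set r : ℝ := s ^ (2 * q)
  have hr0 : 0 ≤ r := by positivity
  have hr : r ≤ 1 / 2 := by
    calc r = (s ^ 2) ^ q := pow_mul _ _ _
      _ ≤ (s ^ 2) ^ 1 := pow_le_pow_of_le_one (by positivity) (by linarith) hq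
      _ ≤ 1 / 2 := by simpa using hss
  have hrp (l : ℕ) : (r ^ l) ^ 2 * (p : ℝ) ^ (2 * q * l) = 1 := by
    rw [← pow_mul, ← pow_mul, ← mul_assoc, mul_comm _ 2, pow_mul s 2, ← mul_pow, hs, one_pow]
  have hexists (l : ℕ) (hl : l ∈ Finset.Icc 1 L) :=
    exists_kernel_aeval_chebyshev_T hG hdeg (by omega) hs hs0 hT (n := 2 * q * l)
      (by nlinarith [(Finset.mem_Icc.1 hl).1])
  choose! k hk hkT using hexists
  set F := hf.toFinset.filter fun y => G.dist x y ≤ 2 * q * L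
  set K : V → ℝ := fun y => ∑ l ∈ Finset.Icc 1 L, k l (G.dist x y)
  have hK (y : V) : |K y| ≤
      p * ∑ l ∈ Finset.Icc 1 L with G.dist x y ≤ 2 * q * l, r ^ l := by
    rw [Finset.mul_sum, Finset.sum_filter]
    refine (Finset.abs_sum_le_sum_abs _ _).trans (Finset.sum_le_sum fun l hl => ?_)
    simpa only [r, ← pow_mul] using hk l hl (G.dist x y)
  have happly : (∑ l ∈ Finset.Icc 1 L, aeval ((1 / 2 : ℝ) • Tp)
      (Chebyshev.T ℝ (2 * q * l))) f x = ∑ y ∈ F, K y * f y := by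
    rw [LinearMap.sum_apply, Finset.sum_apply, Finset.sum_filter_of_ne]
    · simp only [K, Finset.sum_mul]
      rw [Finset.sum_comm]
      refine Finset.sum_congr rfl fun l hl => ?_
      rw [← hkT l hl f hf.toFinset (by simp) x]
      push_cast
      rfl
    · intro y _ hy
      by_contra hlt
      refine hy ?_
      have : K y = 0 := by
        rw [← abs_nonpos_iff]
        refine (hK y).trans_eq ?_
        rw [Finset.filter_false_of_mem, Finset.sum_empty, mul_zero]
        intro l hl h
        exact hlt (h.trans (Nat.mul_le_mul_left _ (Finset.mem_Icc.1 hl).2))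
      rw [this, zero_mul]
  have hKsq : ∑ y ∈ F, K y ^ 2 ≤ 16 * (p : ℝ) ^ 2 * L := by
    calc ∑ y ∈ F, K y ^ 2
        ≤ ∑ y ∈ F, 4 * (p : ℝ) ^ 2 *
            ∑ l ∈ Finset.Icc 1 L, if G.dist x y ≤ 2 * q * l then (r ^ l) ^ 2 else 0 := by
          refine Finset.sum_le_sum fun y _ => ?_
          rw [← sq_abs, ← Finset.sum_filter]
          refine (pow_le_pow_left₀ (abs_nonneg _) (hK y) 2).trans ?_
          rw [mul_pow]
          have := mul_le_mul_of_nonneg_left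
            (sq_sum_pow_le hr0 hr {l ∈ Finset.Icc 1 L | G.dist x y ≤ 2 * q * l})
            (sq_nonneg (p : ℝ))
          linarith
      _ = 4 * (p : ℝ) ^ 2 * ∑ l ∈ Finset.Icc 1 L,
            ({y ∈ F | G.dist x y ≤ 2 * q * l}.card : ℝ) * (r ^ l) ^ 2 := by
          rw [← Finset.mul_sum, Finset.sum_comm]
          simp only [← Finset.sum_filter, Finset.sum_const, nsmul_eq_mul]
      _ ≤ 4 * (p : ℝ) ^ 2 * ∑ l ∈ Finset.Icc 1 L, 4 := by
          gcongr with l hl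
          have hcard : ({y ∈ F | G.dist x y ≤ 2 * q * l}.card : ℝ) ≤ 4 * (p : ℝ) ^ (2 * q * l) := by
            exact_mod_cast hG.card_filter_dist_le hdeg hp x (2 * q * l) F
          calc _ ≤ 4 * (p : ℝ) ^ (2 * q * l) * (r ^ l) ^ 2 := by gcongr
            _ = 4 := by rw [mul_assoc, mul_comm _ ((r ^ l) ^ 2), hrp, mul_one]
      _ = 16 * (p : ℝ) ^ 2 * L := by
          rw [Finset.sum_const, Nat.card_Icc, nsmul_eq_mul]
          push_cast [Nat.add_sub_cancel]
          ring
  rw [happly]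
  refine (Finset.sum_mul_sq_le_sq_mul_sq F K f).trans ?_
  gcongr
end
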